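/- Let δ ∈ ℝ, T > 0 and N ≥ 1. Suppose A^a(t,x) (a = 1, 2, 3) are symmetric N×N matrix-valued functions such that A^a, the spatial derivatives ∂_a A^a, and B are bounded on [0,T]×ℝ³, and F(t,·) ∈ L²_δ(ℝ³;ℝ^N) for each t. If U ∈ C¹([0,T], L²_δ(ℝ³;ℝ^N)) solves the linear symmetric hyperbolic system ∂_t U + Σ_{a=1}^3 A^a ∂_a U + B U = F on [0,T]×ℝ³, then for t ∈ [0,T], (1/2)(d/dt)‖U(t)‖²_{L²_δ} ≤ C (‖U(t)‖²_{L²_δ} + ‖F(t,·)‖²_{L²_δ}), where the constant C depends only on δ and the L^∞-norms of A^a, ∂_a A^a and B. -/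

import Mathlib

open MeasureTheory Real Set
open scoped FourierTransform ENNReal NNReal

noncomputable section

abbrev E3 : Type := EuclideanSpace ℝ (Fin 3)

/-- A dyadic partition of unity on ℝ³ as in the paper: `ψ j ∈ C_0^∞`, nonnegative,
`supp ψ₀ ⊆ {|x| ≤ 2}`, `ψ₀ = 1` on `{|x| ≤ 1}`, for `j ≥ 1`
`supp ψ_j ⊆ {2^(j-2) ≤ |x| ≤ 2^(j+1)}`, `ψ_j = 1` on `{2^(j-1) ≤ |x| ≤ 2^j}`, and
`|∂^α ψ_j| ≤ C_α 2^(-|α| j)` with `C_α` independent of `j`. -/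
structure DyadicPartition where
  ψ : ℕ → E3 → ℝ
  smooth : ∀ j, ContDiff ℝ (⊤ : ℕ∞) (ψ j)
  nonneg : ∀ j x, 0 ≤ ψ j x
  compSupp : ∀ j, HasCompactSupport (ψ j)
  supp_zero : ∀ x : E3, ψ 0 x ≠ 0 → ‖x‖ ≤ 2
  one_zero : ∀ x : E3, ‖x‖ ≤ 1 → ψ 0 x = 1
  supp_succ : ∀ j : ℕ, 1 ≤ j → ∀ x : E3, ψ j x ≠ 0 →
    (2:ℝ) ^ ((j:ℤ) - 2) ≤ ‖x‖ ∧ ‖x‖ ≤ (2:ℝ) ^ ((j:ℤ) + 1)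
  one_succ : ∀ j : ℕ, 1 ≤ j → ∀ x : E3,
    (2:ℝ) ^ ((j:ℤ) - 1) ≤ ‖x‖ → ‖x‖ ≤ (2:ℝ) ^ (j:ℤ) → ψ j x = 1
  deriv_bound : ∀ n : ℕ, ∃ C : ℝ, ∀ (j : ℕ) (x : E3),
    ‖iteratedFDeriv ℝ n (ψ j) x‖ ≤ C * (2:ℝ) ^ (-(n:ℤ) * (j:ℤ))

/-- The squared `H^s` norm `∫ (1+|ξ|²)^s |𝓕f(ξ)|² dξ` of a complex-valued function. -/
def HsNormSq (s : ℝ) (f : E3 → ℂ) : ℝ≥0∞ :=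
  ∫⁻ ξ : E3, ENNReal.ofReal ((1 + ‖ξ‖ ^ 2) ^ s) * (‖𝓕 f ξ‖₊ : ℝ≥0∞) ^ 2

/-- The squared weighted Sobolev norm
`‖u‖²_{H_{s,δ}} = Σ_j 2^{(3/2+δ)2j} ‖(ψ_j u)_{2^j}‖²_{H^s}`,
where `(ψ_j u)_{2^j}(x) = ψ_j(2^j x) u(2^j x)`. -/
def HwNormSq (P : DyadicPartition) (s δ : ℝ) (u : E3 → ℝ) : ℝ≥0∞ :=
  ∑' j : ℕ, ENNReal.ofReal ((2:ℝ) ^ ((3 + 2 * δ) * (j:ℝ))) *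
    HsNormSq s (fun x : E3 =>
      ((P.ψ j (((2:ℝ) ^ (j:ℕ)) • x) * u (((2:ℝ) ^ (j:ℕ)) • x) : ℝ) : ℂ))

/-- Membership in the weighted Sobolev space `H_{s,δ}` (for functions). -/
def MemH (P : DyadicPartition) (s δ : ℝ) (u : E3 → ℝ) : Prop :=
  LocallyIntegrable u volume ∧ HwNormSq P s δ u < ⊤

/-- The weighted Sobolev norm `‖u‖_{H_{s,δ}}`. -/
def Hnorm (P : DyadicPartition) (s δ : ℝ) (u : E3 → ℝ) : ℝ :=
  Real.sqrt (HwNormSq P s δ u).toReal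

/-- The squared weighted `L²_δ` norm `∫ (1+|x|)^{2δ} |u(x)|² dx`. -/
def L2wNormSq (δ : ℝ) (u : E3 → ℝ) : ℝ≥0∞ :=
  ∫⁻ x : E3, ENNReal.ofReal ((1 + ‖x‖) ^ (2 * δ)) * (‖u x‖₊ : ℝ≥0∞) ^ 2

/-- The weighted `L²_δ` norm. -/
def L2wNorm (δ : ℝ) (u : E3 → ℝ) : ℝ :=
  Real.sqrt (L2wNormSq δ u).toReal

/-- Membership in `L²_δ`. -/
def MemL2w (δ : ℝ) (u : E3 → ℝ) : Prop :=
  AEStronglyMeasurable u volume ∧ L2wNormSq δ u < ⊤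

/-- The partial derivative `∂_a f (x)`. -/
def pd (f : E3 → ℝ) (a : Fin 3) (x : E3) : ℝ :=
  fderiv ℝ f x (EuclideanSpace.single a 1)

/-- `t ↦ u(t,·)` is a continuous curve in `L²_δ` on `[0,T]`. -/
def L2ContOn (δ T : ℝ) (u : ℝ → E3 → ℝ) : Prop :=
  (∀ t ∈ Icc (0:ℝ) T, MemL2w δ (u t)) ∧
  ∀ t ∈ Icc (0:ℝ) T, ∀ ε > (0:ℝ), ∃ η > (0:ℝ), ∀ t' ∈ Icc (0:ℝ) T,
    |t' - t| < η → L2wNorm δ (fun x => u t' x - u t x) < ε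

/-- `t ↦ u(t,·)` is a `C¹` curve in `L²_δ` on `[0,T]`. -/
def L2C1On (δ T : ℝ) (u : ℝ → E3 → ℝ) : Prop :=
  ∃ u' : ℝ → E3 → ℝ, L2ContOn δ T u' ∧
    ∀ t ∈ Icc (0:ℝ) T, ∀ ε > (0:ℝ), ∃ η > (0:ℝ), ∀ t' ∈ Icc (0:ℝ) T, t' ≠ t →
      |t' - t| < η →
      L2wNorm δ (fun x => (u t' x - u t x) / (t' - t) - u' t x) < ε

/-- The divergence of a compactly supported continuous vector field, differentiable off a countable
set and with integrable divergence, has zero integral. -/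
theorem integral_sum_pd_eq_zero {g : Fin 3 → E3 → ℝ} {s : Set E3} (hs : s.Countable)
    (hc : ∀ a, Continuous (g a)) (hd : ∀ a, ∀ x ∉ s, DifferentiableAt ℝ (g a) x)
    (hsupp : ∀ a, HasCompactSupport (g a))
    (hi : Integrable (fun x => ∑ a, pd (g a) a x)) :
    ∫ x, ∑ a, pd (g a) a x = 0 := by
  obtain ⟨R, hR⟩ : ∃ R : ℝ, ∀ a, ∀ x ∈ tsupport (g a), ‖x‖ < R := by
    have h : Bornology.IsBounded (⋃ a, tsupport (g a)) :=
      Bornology.isBounded_iUnion.2 fun a => (hsupp a).isCompact.isBounded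
    obtain ⟨R, -, hR⟩ := h.exists_pos_norm_lt
    exact ⟨R, fun a x hx => hR x (mem_iUnion.2 ⟨a, hx⟩)⟩
  have hR0 : 0 ≤ max R 0 := le_max_right _ _
  have hzero : ∀ a, ∀ x : E3, max R 0 ≤ ‖x‖ → x ∉ tsupport (g a) := fun a x hx hx' =>
    absurd (hR a x hx') (not_lt.2 ((le_max_left _ _).trans hx))
  have hcoord : ∀ (y : Fin 3 → ℝ) (k : Fin 3), |y k| ≤ ‖WithLp.toLp 2 y‖ := fun y k => by
    simpa using PiLp.norm_apply_le (WithLp.toLp 2 y) k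
  have hmp := PiLp.volume_preserving_toLp (Fin 3)
  have hemb : MeasurableEmbedding (@WithLp.toLp 2 (Fin 3 → ℝ)) :=
    (MeasurableEquiv.toLp 2 (Fin 3 → ℝ)).measurableEmbedding
  let L : (Fin 3 → ℝ) ≃L[ℝ] E3 := (PiLp.continuousLinearEquiv 2 ℝ (fun _ : Fin 3 => ℝ)).symm
  have hL : ∀ y, L y = WithLp.toLp 2 y := fun y => rfl
  have hpd : ∀ y, (∑ a, ((fderiv ℝ (g a) (L y)).comp (L : (Fin 3 → ℝ) →L[ℝ] E3)) (Pi.single a 1))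
      = ∑ a, pd (g a) a (WithLp.toLp 2 y) := fun y => by
    simp [pd, hL]
  have hint := (hmp.integrable_comp_emb hemb).2 hi
  have key := integral_divergence_of_hasFDerivAt_off_countable'
    (fun _ => -max R 0) (fun _ => max R 0) (fun _ => by linarith)
    (fun a y => g a (L y)) (fun a y => (fderiv ℝ (g a) (L y)).comp (L : (Fin 3 → ℝ) →L[ℝ] E3))
    (L ⁻¹' s) (hs.preimage L.injective)
    (fun a => ((hc a).comp L.continuous).continuousOn)
    (fun y hy a => (hd a (L y) hy.2).hasFDerivAt.comp y L.hasFDerivAt)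
    (by simp_rw [hpd]; exact hint.integrableOn)
  simp_rw [hpd] at key
  rw [← hmp.integral_comp hemb,
    ← setIntegral_eq_integral_of_forall_compl_eq_zero
      (s := Icc (fun _ => -max R 0) (fun _ => max R 0)), key]
  · refine Finset.sum_eq_zero fun a _ => ?_
    have hface : ∀ (c : ℝ) (z : Fin 2 → ℝ), |c| = max R 0 → g a (L (a.insertNth c z)) = 0 :=
      fun c z hcR => image_eq_zero_of_notMem_tsupport <| hzero a _ <| by
        simpa [hcR, hL] using hcoord (a.insertNth c z) a
    simp [hface, abs_of_nonneg hR0]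
  · intro y hy
    refine Finset.sum_eq_zero fun a _ => ?_
    have hfar : max R 0 ≤ ‖WithLp.toLp 2 y‖ := by
      by_contra! hlt
      refine hy ⟨fun k => ?_, fun k => ?_⟩
      · exact (abs_le.1 ((hcoord y k).trans hlt.le)).1
      · exact (abs_le.1 ((hcoord y k).trans hlt.le)).2
    rw [pd, fderiv_of_notMem_tsupport ℝ (hzero a _ hfar)]
    simp

/-- The weight `(1 + |x|)^(2δ)`. -/
def weight (δ : ℝ) (x : E3) : ℝ := (1 + ‖x‖) ^ (2 * δ)

theorem weight_pos (δ : ℝ) (x : E3) : 0 < weight δ x :=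
  Real.rpow_pos_of_pos (by positivity) _

theorem continuous_weight (δ : ℝ) : Continuous (weight δ) :=
  (by fun_prop : Continuous fun x : E3 => 1 + ‖x‖).rpow_const fun x =>
    Or.inl (by positivity : 1 + ‖x‖ ≠ 0)

theorem measurable_pd (f : E3 → ℝ) (a : Fin 3) : Measurable (pd f a) :=
  measurable_fderiv_apply_const ℝ f _

theorem pd_mul {f g : E3 → ℝ} {x : E3} (hf : DifferentiableAt ℝ f x)
    (hg : DifferentiableAt ℝ g x) (a : Fin 3) :
    pd (fun y => f y * g y) a x = f x * pd g a x + pd f a x * g x := by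
  simp only [pd]
  rw [fderiv_fun_mul hf hg]
  simp [mul_comm]

theorem abs_pd_le (f : E3 → ℝ) (a : Fin 3) (x : E3) : |pd f a x| ≤ ‖fderiv ℝ f x‖ := by
  simpa [pd] using (fderiv ℝ f x).le_opNorm (EuclideanSpace.single a (1 : ℝ))

theorem differentiableAt_weight (δ : ℝ) {x : E3} (hx : x ≠ 0) :
    DifferentiableAt ℝ (weight δ) x :=
  (((contDiffAt_norm ℝ hx).differentiableAt (n := 1) one_ne_zero).const_add 1).rpow_const
    (Or.inl (by positivity : 1 + ‖x‖ ≠ 0))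

theorem abs_pd_weight_le (δ : ℝ) (a : Fin 3) {x : E3} (hx : x ≠ 0) :
    |pd (weight δ) a x| ≤ 2 * |δ| * weight δ x := by
  have hpos : 0 < 1 + ‖x‖ := by positivity
  have hn := ((contDiffAt_norm ℝ hx).differentiableAt (n := 1) one_ne_zero).hasFDerivAt
  have hw : HasFDerivAt (weight δ) _ x := (hn.const_add 1).rpow_const (p := 2 * δ) (Or.inl hpos.ne')
  have h1 : ‖fderiv ℝ (fun y : E3 => ‖y‖) x‖ ≤ 1 := by
    simpa using norm_fderiv_le_of_lipschitz ℝ (x₀ := x) (lipschitzWith_one_norm (E := E3))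
  calc |pd (weight δ) a x| ≤ ‖fderiv ℝ (weight δ) x‖ := abs_pd_le _ _ _
    _ = 2 * |δ| * (1 + ‖x‖) ^ (2 * δ - 1) * ‖fderiv ℝ (fun y : E3 => ‖y‖) x‖ := by
      rw [hw.fderiv, norm_smul, Real.norm_eq_abs, abs_mul, abs_mul, abs_two,
        abs_of_nonneg (Real.rpow_nonneg hpos.le _)]
    _ ≤ 2 * |δ| * (1 + ‖x‖) ^ (2 * δ) * 1 := by
      gcongr
      · linarith [norm_nonneg x]
      · linarith
    _ = 2 * |δ| * weight δ x := by rw [mul_one, weight]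

/-- Smooth compactly supported cutoffs with uniformly bounded gradients exhausting `ℝ³`. -/
theorem exists_cutoff : ∃ K : ℝ, 0 ≤ K ∧ ∃ χ : ℕ → E3 → ℝ,
    (∀ n, Differentiable ℝ (χ n)) ∧ (∀ n, HasCompactSupport (χ n)) ∧
    (∀ n x, |χ n x| ≤ 1) ∧ (∀ n a x, |pd (χ n) a x| ≤ K) ∧
    ∀ x, Filter.Tendsto (fun n => χ n x) Filter.atTop (nhds 1) := by
  let f : ContDiffBump (0 : E3) := ⟨1, 2, one_pos, one_lt_two⟩
  have hf : Differentiable ℝ f := (f.contDiff (n := 1)).differentiable one_ne_zero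
  obtain ⟨K, hK⟩ := (f.hasCompactSupport.fderiv ℝ).exists_bound_of_continuous
    ((f.contDiff (n := 1)).continuous_fderiv one_ne_zero)
  have hc : ∀ n : ℕ, ((n : ℝ) + 1)⁻¹ ≠ 0 := fun n => by positivity
  refine ⟨K, (norm_nonneg _).trans (hK 0), fun n x => f (((n : ℝ) + 1)⁻¹ • x), fun n => ?_,
    fun n => ?_, fun n x => ?_, fun n a x => ?_, fun x => ?_⟩
  · exact hf.comp (differentiable_id.fun_const_smul _)
  · exact f.hasCompactSupport.comp_smul (hc n)
  · rw [abs_of_nonneg f.nonneg]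
    exact f.le_one
  · refine (abs_pd_le _ _ _).trans ?_
    rw [fderiv_comp_smul, norm_smul]
    have h1 : ‖((n : ℝ) + 1)⁻¹‖ ≤ 1 := by
      rw [norm_inv, Real.norm_eq_abs, abs_of_nonneg (by positivity)]
      exact inv_le_one_of_one_le₀ (by linarith [(Nat.cast_nonneg n : (0 : ℝ) ≤ n)])
    calc _ ≤ 1 * K := mul_le_mul h1 (hK _) (norm_nonneg _) zero_le_one
      _ = K := one_mul K
  · refine tendsto_const_nhds.congr' ?_
    obtain ⟨m, hm⟩ := exists_nat_ge ‖x‖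
    filter_upwards [Filter.eventually_ge_atTop m] with n hn
    refine (f.one_of_mem_closedBall ?_).symm
    have hmn : (m : ℝ) ≤ n := Nat.cast_le.2 hn
    rw [mem_closedBall_zero_iff, norm_smul, norm_inv, Real.norm_eq_abs,
      abs_of_nonneg (by positivity), inv_mul_le_iff₀ (by positivity)]
    change ‖x‖ ≤ ((n : ℝ) + 1) * 1
    linarith

/-- Weighted integration by parts: the weighted integral of a divergence is controlled by the
weighted `L¹` norm of the field. -/
theorem exists_abs_integral_weight_mul_div_le (δ : ℝ) : ∃ K : ℝ, 0 ≤ K ∧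
    ∀ q : Fin 3 → E3 → ℝ, (∀ a, Differentiable ℝ (q a)) →
      (∀ a, Integrable (fun x => weight δ x * q a x)) →
      Integrable (fun x => weight δ x * ∑ a, pd (q a) a x) →
      |∫ x, weight δ x * ∑ a, pd (q a) a x| ≤ K * ∑ a, ∫ x, weight δ x * |q a x| := by
  obtain ⟨K, hK0, χ, hχd, hχs, hχ1, hχK, hχt⟩ := exists_cutoff
  refine ⟨K + 2 * |δ|, by positivity, fun q hq hqi hdi => ?_⟩
  have hw := continuous_weight δ
  have hφd : ∀ n, ∀ x : E3, x ≠ 0 → DifferentiableAt ℝ (fun y => χ n y * weight δ y) x :=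
    fun n x hx => (hχd n x).mul (differentiableAt_weight δ hx)
  have hφb : ∀ n a, ∀ x : E3, x ≠ 0 →
      |pd (fun y => χ n y * weight δ y) a x| ≤ (K + 2 * |δ|) * weight δ x := by
    intro n a x hx
    rw [pd_mul (hχd n x) (differentiableAt_weight δ hx)]
    calc _ ≤ |χ n x| * |pd (weight δ) a x| + |pd (χ n) a x| * weight δ x := by
          refine (abs_add_le _ _).trans ?_
          rw [abs_mul, abs_mul, abs_of_pos (weight_pos δ x)]
      _ ≤ 1 * (2 * |δ| * weight δ x) + K * weight δ x := by
          have := (weight_pos δ x).le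
          gcongr
          exacts [hχ1 n x, abs_pd_weight_le δ a hx, hχK n a x]
      _ = _ := by ring
  have hae : ∀ᵐ x : E3, x ≠ 0 := by
    rw [ae_iff]; simp
  have hqabs : ∀ a, Integrable (fun x => weight δ x * |q a x|) := fun a => by
    simpa [abs_mul, abs_of_pos (weight_pos δ _)] using (hqi a).abs
  have hi1 : ∀ n, Integrable (fun x => χ n x * (weight δ x * ∑ a, pd (q a) a x)) := fun n =>
    hdi.bdd_mul (c := 1) (hχd n).continuous.aestronglyMeasurable
      (Filter.Eventually.of_forall (hχ1 n))
  have hbd : ∀ n a, ∀ᵐ x : E3, ‖pd (fun y => χ n y * weight δ y) a x * q a x‖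
      ≤ (K + 2 * |δ|) * (weight δ x * |q a x|) := fun n a => by
    filter_upwards [hae] with x hx
    rw [norm_mul, Real.norm_eq_abs, Real.norm_eq_abs, ← mul_assoc]
    exact mul_le_mul_of_nonneg_right (hφb n a x hx) (abs_nonneg _)
  have hi2 : ∀ n a, Integrable (fun x => pd (fun y => χ n y * weight δ y) a x * q a x) :=
    fun n a => ((hqabs a).const_mul _).mono'
      ((measurable_pd _ a).mul (hq a).continuous.measurable).aestronglyMeasurable (hbd n a)
  have hdiv : ∀ n, (fun x => ∑ a, pd (fun y => χ n y * weight δ y * q a y) a x) =ᵐ[volume]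
      fun x => χ n x * (weight δ x * ∑ a, pd (q a) a x)
        + ∑ a, pd (fun y => χ n y * weight δ y) a x * q a x := fun n => by
    filter_upwards [hae] with x hx
    simp_rw [pd_mul (hφd n x hx) (hq _ x), Finset.sum_add_distrib, Finset.mul_sum, mul_assoc]
  have hbound : ∀ n, |∫ x, χ n x * (weight δ x * ∑ a, pd (q a) a x)|
      ≤ (K + 2 * |δ|) * ∑ a, ∫ x, weight δ x * |q a x| := by
    intro n
    have hsum : Integrable (fun x => ∑ a, pd (fun y => χ n y * weight δ y) a x * q a x) :=
      integrable_finsetSum _ fun a _ => hi2 n a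
    have h0 := integral_sum_pd_eq_zero (g := fun a y => χ n y * weight δ y * q a y)
      (countable_singleton (0 : E3))
      (fun a => ((hχd n).continuous.mul hw).mul (hq a).continuous)
      (fun a x hx => (hφd n x hx).mul (hq a x))
      (fun a => (hχs n).mul_right.mul_right)
      (((hi1 n).add hsum).congr (hdiv n).symm)
    rw [integral_congr_ae (hdiv n), integral_add (hi1 n) hsum,
      integral_finsetSum _ fun a _ => hi2 n a] at h0
    rw [eq_neg_of_add_eq_zero_left h0, abs_neg, Finset.mul_sum]
    refine (Finset.abs_sum_le_sum_abs _ _).trans (Finset.sum_le_sum fun a _ => ?_)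
    rw [← integral_const_mul]
    exact norm_integral_le_of_norm_le ((hqabs a).const_mul _) (hbd n a)
  have hlim : Filter.Tendsto (fun n => ∫ x, χ n x * (weight δ x * ∑ a, pd (q a) a x)) Filter.atTop
      (nhds (∫ x, weight δ x * ∑ a, pd (q a) a x)) := by
    refine tendsto_integral_of_dominated_convergence
      (fun x => ‖weight δ x * ∑ a, pd (q a) a x‖) (fun n => (hi1 n).aestronglyMeasurable)
      hdi.norm (fun n => Filter.Eventually.of_forall fun x => ?_)
      (Filter.Eventually.of_forall fun x => ?_)
    · rw [norm_mul]
      exact mul_le_of_le_one_left (norm_nonneg _) (hχ1 n x)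
    · simpa using (hχt x).mul_const (weight δ x * ∑ a, pd (q a) a x)
  exact le_of_tendsto hlim.abs (Filter.Eventually.of_forall hbound)

/-- The measure `(1 + |x|)^(2δ) dx`, for which `L²_δ` is the usual `L²` space. -/
def weightedVolume (δ : ℝ) : Measure E3 :=
  volume.withDensity fun x => ENNReal.ofReal (weight δ x)

theorem measurable_ofReal_weight (δ : ℝ) : Measurable fun x => ENNReal.ofReal (weight δ x) :=
  (continuous_weight δ).measurable.ennreal_ofReal

theorem integral_weightedVolume (δ : ℝ) (f : E3 → ℝ) :
    ∫ x, f x ∂weightedVolume δ = ∫ x, weight δ x * f x := by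
  rw [weightedVolume, integral_withDensity_eq_integral_toReal_smul (measurable_ofReal_weight δ)
    (Filter.Eventually.of_forall fun _ => ENNReal.ofReal_lt_top)]
  simp [ENNReal.toReal_ofReal (weight_pos δ _).le]

theorem integrable_weightedVolume_iff {δ : ℝ} {f : E3 → ℝ} :
    Integrable f (weightedVolume δ) ↔ Integrable fun x => weight δ x * f x := by
  rw [weightedVolume, integrable_withDensity_iff_integrable_smul' (measurable_ofReal_weight δ)
    (Filter.Eventually.of_forall fun _ => ENNReal.ofReal_lt_top)]
  simp [ENNReal.toReal_ofReal (weight_pos δ _).le]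

theorem L2wNormSq_eq_eLpNorm_sq (δ : ℝ) (u : E3 → ℝ) :
    L2wNormSq δ u = eLpNorm u 2 (weightedVolume δ) ^ 2 := by
  have h := eLpNorm_nnreal_pow_eq_lintegral (f := u) (μ := weightedVolume δ) (p := 2) two_ne_zero
  simp only [NNReal.coe_ofNat, ENNReal.rpow_ofNat, ENNReal.coe_ofNat] at h
  rw [h, weightedVolume, lintegral_withDensity_eq_lintegral_mul_non_measurable _
    (measurable_ofReal_weight δ) (Filter.Eventually.of_forall fun _ => ENNReal.ofReal_lt_top)]
  rfl

theorem L2wNorm_eq_toReal_eLpNorm (δ : ℝ) (u : E3 → ℝ) :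
    L2wNorm δ u = (eLpNorm u 2 (weightedVolume δ)).toReal := by
  rw [L2wNorm, L2wNormSq_eq_eLpNorm_sq, ENNReal.toReal_pow, Real.sqrt_sq ENNReal.toReal_nonneg]

theorem MemL2w.memLp {δ : ℝ} {u : E3 → ℝ} (hu : MemL2w δ u) : MemLp u 2 (weightedVolume δ) := by
  refine ⟨hu.1.mono_ac (withDensity_absolutelyContinuous _ _), ?_⟩
  have h := hu.2
  rw [L2wNormSq_eq_eLpNorm_sq] at h
  exact (ENNReal.pow_lt_top_iff.1 h).resolve_right two_ne_zero

theorem MemL2w.L2wNorm_sq_eq_integral {δ : ℝ} {u : E3 → ℝ} (hu : MemL2w δ u) :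
    L2wNorm δ u ^ 2 = ∫ x, u x ^ 2 ∂weightedVolume δ := by
  have h := hu.memLp
  rw [L2wNorm_eq_toReal_eLpNorm, ← Lp.norm_toLp u h, ← real_inner_self_eq_norm_sq, L2.inner_def]
  refine integral_congr_ae ?_
  filter_upwards [h.coeFn_toLp] with x hx
  simp [hx, sq]

/-- `u'` is the derivative in `L²_δ` of the curve `u` at the time `t`, within `[0,T]`. -/
def HasL2DerivAt (δ T : ℝ) (u : ℝ → E3 → ℝ) (u' : E3 → ℝ) (t : ℝ) : Prop :=
  ∀ ε > (0 : ℝ), ∃ η > (0 : ℝ), ∀ t' ∈ Icc (0 : ℝ) T, t' ≠ t → |t' - t| < η →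
    L2wNorm δ (fun x => (u t' x - u t x) / (t' - t) - u' x) < ε

theorem HasL2DerivAt.tendsto {δ T : ℝ} {u : ℝ → E3 → ℝ} {u' : E3 → ℝ} {t : ℝ}
    (h : HasL2DerivAt δ T u u' t) :
    Filter.Tendsto (fun t' => L2wNorm δ (fun x => (u t' x - u t x) / (t' - t) - u' x))
      (nhdsWithin t (Icc 0 T \ {t})) (nhds 0) := by
  rw [Metric.tendsto_nhdsWithin_nhds]
  intro ε hε
  obtain ⟨η, hη, H⟩ := h ε hε
  refine ⟨η, hη, fun t' ht' hd => ?_⟩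
  rw [Real.dist_eq, sub_zero, L2wNorm, abs_of_nonneg (Real.sqrt_nonneg _)]
  exact H t' ht'.1 ht'.2 hd

theorem HasL2DerivAt.hasDerivWithinAt_normSq {δ T : ℝ} {u : ℝ → E3 → ℝ} {u' : E3 → ℝ} {t : ℝ}
    (hu : ∀ t ∈ Icc (0 : ℝ) T, MemL2w δ (u t)) (hu' : MemL2w δ u') (ht : t ∈ Icc (0 : ℝ) T)
    (h : HasL2DerivAt δ T u u' t) :
    HasDerivWithinAt (fun τ => (L2wNormSq δ (u τ)).toReal)
      (2 * ∫ x, u t x * u' x ∂weightedVolume δ) (Icc 0 T) t := by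
  classical
  let V : ℝ → Lp ℝ 2 (weightedVolume δ) := fun τ =>
    if hτ : τ ∈ Icc (0 : ℝ) T then (hu τ hτ).memLp.toLp (u τ) else 0
  have hV : ∀ τ (hτ : τ ∈ Icc (0 : ℝ) T), V τ = (hu τ hτ).memLp.toLp (u τ) :=
    fun τ hτ => dif_pos hτ
  have hder : HasDerivWithinAt V (hu'.memLp.toLp u') (Icc 0 T) t := by
    rw [hasDerivWithinAt_iff_tendsto_slope, tendsto_iff_norm_sub_tendsto_zero]
    refine h.tendsto.congr' ?_
    filter_upwards [self_mem_nhdsWithin] with t' ht'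
    rw [slope_def_module, hV t ht, hV t' ht'.1, ← MemLp.toLp_sub, ← MemLp.toLp_const_smul,
      ← MemLp.toLp_sub, Lp.norm_toLp, L2wNorm_eq_toReal_eLpNorm]
    congr 2
    ext x
    simp [div_eq_inv_mul]
  have hinner : inner ℝ (V t) (hu'.memLp.toLp u') = ∫ x, u t x * u' x ∂weightedVolume δ := by
    rw [hV t ht, L2.inner_def]
    refine integral_congr_ae ?_
    filter_upwards [(hu t ht).memLp.coeFn_toLp, hu'.memLp.coeFn_toLp] with x hx hx'
    simp [hx, hx', mul_comm]
  have hnorm : ∀ τ ∈ Icc (0 : ℝ) T, (L2wNormSq δ (u τ)).toReal = ‖V τ‖ ^ 2 := fun τ hτ => by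
    rw [hV τ hτ, Lp.norm_toLp, L2wNormSq_eq_eLpNorm_sq, ENNReal.toReal_pow]
  rw [← hinner]
  exact hder.norm_sq.congr hnorm (hnorm t ht)

/-- The derivative in `L²_δ` agrees almost everywhere with the pointwise derivative. -/
theorem HasL2DerivAt.ae_eq_of_hasDerivWithinAt {δ T : ℝ} {u : ℝ → E3 → ℝ} {u' v : E3 → ℝ} {t : ℝ}
    (hT : 0 < T) (hu : ∀ t ∈ Icc (0 : ℝ) T, MemL2w δ (u t)) (hu' : MemL2w δ u')
    (ht : t ∈ Icc (0 : ℝ) T) (h : HasL2DerivAt δ T u u' t)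
    (hv : ∀ x, HasDerivWithinAt (fun τ => u τ x) (v x) (Icc 0 T) t) :
    u' =ᵐ[weightedVolume δ] v := by
  have : (nhdsWithin t (Icc 0 T \ {t})).NeBot :=
    accPt_principal_iff_nhdsWithin.1 (uniqueDiffOn_Icc hT t ht).accPt
  obtain ⟨s, hs⟩ := Filter.exists_seq_tendsto (nhdsWithin t (Icc 0 T \ {t}))
  have hsI : ∀ᶠ n in Filter.atTop, s n ∈ Icc 0 T \ {t} := hs.eventually self_mem_nhdsWithin
  obtain ⟨m, hm⟩ := Filter.eventually_atTop.1 hsI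
  have hs' : Filter.Tendsto (fun n => s (n + m)) Filter.atTop (nhdsWithin t (Icc 0 T \ {t})) :=
    hs.comp (Filter.tendsto_add_atTop_nat m)
  have hmem : ∀ n, s (n + m) ∈ Icc 0 T \ {t} := fun n => hm _ (Nat.le_add_left _ _)
  have hq : ∀ n, MemLp (fun x => (u (s (n + m)) x - u t x) / (s (n + m) - t)) 2
      (weightedVolume δ) := fun n => by
    simpa [div_eq_inv_mul] using
      ((hu _ (hmem n).1).memLp.sub (hu t ht).memLp).const_mul (s (n + m) - t)⁻¹
  have hlim : Filter.Tendsto (fun n => eLpNorm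
      ((fun x => (u (s (n + m)) x - u t x) / (s (n + m) - t)) - u') 2 (weightedVolume δ))
      Filter.atTop (nhds 0) := by
    have h1 := h.tendsto.comp hs'
    simp only [Function.comp_def, L2wNorm_eq_toReal_eLpNorm] at h1
    rw [← ENNReal.toReal_zero] at h1
    exact (ENNReal.tendsto_toReal_iff (fun n => ((hq n).sub hu'.memLp).2.ne)
      ENNReal.zero_ne_top).1 h1
  obtain ⟨φ, hφ, hae⟩ := (tendstoInMeasure_of_tendsto_eLpNorm two_ne_zero
    (fun n => (hq n).1) hu'.memLp.1 hlim).exists_seq_tendsto_ae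
  filter_upwards [hae] with x hx
  have h2 := ((hasDerivWithinAt_iff_tendsto_slope.1 (hv x)).comp hs').comp hφ.tendsto_atTop
  refine tendsto_nhds_unique hx (h2.congr fun n => ?_)
  simp [slope_def_field]

theorem abs_sum_mul_mul_le {N : ℕ} {M : ℝ} {c : Fin N → Fin N → ℝ} (hc : ∀ i j, |c i j| ≤ M)
    (v : Fin N → ℝ) : |∑ i, ∑ j, c i j * v i * v j| ≤ |M| * N * ∑ i, v i ^ 2 := by
  have hterm : ∀ i j, |c i j * v i * v j| ≤ |M| * ((v i ^ 2 + v j ^ 2) / 2) := fun i j => by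
    rw [mul_assoc, abs_mul]
    refine mul_le_mul ((hc i j).trans (le_abs_self M)) ?_ (abs_nonneg _) (abs_nonneg _)
    rw [abs_le]
    constructor <;> nlinarith [sq_nonneg (v i - v j), sq_nonneg (v i + v j)]
  calc |∑ i, ∑ j, c i j * v i * v j| ≤ ∑ i, ∑ j, |M| * ((v i ^ 2 + v j ^ 2) / 2) :=
        (Finset.abs_sum_le_sum_abs _ _).trans <| Finset.sum_le_sum fun i _ =>
          (Finset.abs_sum_le_sum_abs _ _).trans <| Finset.sum_le_sum fun j _ => hterm i j
    _ = |M| * N * ∑ i, v i ^ 2 := by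
        simp only [← Finset.mul_sum, ← Finset.sum_div, Finset.sum_add_distrib, Finset.sum_const,
          Finset.card_univ, Fintype.card_fin, nsmul_eq_mul]
        ring

theorem pd_quadratic {N : ℕ} {A : E3 → Fin N → Fin N → ℝ} {U : E3 → Fin N → ℝ} {x : E3}
    (hA : ∀ i j, DifferentiableAt ℝ (fun y => A y i j) x)
    (hU : ∀ i, DifferentiableAt ℝ (fun y => U y i) x)
    (hsymm : ∀ i j, A x i j = A x j i) (a : Fin 3) :
    pd (fun y => ∑ i, ∑ j, A y i j * U y i * U y j) a x =
      (∑ i, ∑ j, pd (fun y => A y i j) a x * U x i * U x j) +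
        2 * ∑ i, U x i * ∑ j, A x i j * pd (fun y => U y j) a x := by
  have hd : ∀ i j, DifferentiableAt ℝ (fun y => A y i j * U y i * U y j) x :=
    fun i j => ((hA i j).mul (hU i)).mul (hU j)
  have hsum : pd (fun y => ∑ i, ∑ j, A y i j * U y i * U y j) a x =
      ∑ i, ∑ j, pd (fun y => A y i j * U y i * U y j) a x := by
    simp only [pd]
    rw [fderiv_fun_sum fun i _ => DifferentiableAt.fun_sum fun j _ => hd i j]
    simp only [FunLike.coe_sum, Finset.sum_apply]
    refine Finset.sum_congr rfl fun i _ => ?_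
    rw [fderiv_fun_sum fun j _ => hd i j]
    simp
  have hswap : ∑ i, ∑ j, A x i j * pd (fun y => U y i) a x * U x j =
      ∑ i, ∑ j, U x i * (A x i j * pd (fun y => U y j) a x) := by
    rw [Finset.sum_comm]
    refine Finset.sum_congr rfl fun i _ => Finset.sum_congr rfl fun j _ => ?_
    rw [hsymm j i]
    ring
  have hterm : ∀ i j, pd (fun y => A y i j * U y i * U y j) a x =
      U x i * (A x i j * pd (fun y => U y j) a x) + A x i j * pd (fun y => U y i) a x * U x j +
        pd (fun y => A y i j) a x * U x i * U x j := fun i j => by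
    rw [pd_mul ((hA i j).fun_mul (hU i)) (hU j), pd_mul (hA i j) (hU i)]
    ring
  simp only [hsum, hterm, Finset.sum_add_distrib, hswap, ← Finset.mul_sum]
  ring

/-- The energy estimate at a fixed time, with `V` playing the role of `∂ₜU`. -/
theorem exists_integral_sum_mul_le (δ : ℝ) (N : ℕ) (M : ℝ) : ∃ C : ℝ, 0 < C ∧
    ∀ (A : Fin 3 → E3 → Fin N → Fin N → ℝ) (B : E3 → Fin N → Fin N → ℝ)
      (F U V : E3 → Fin N → ℝ),
      (∀ a x i j, |A a x i j| ≤ M) →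
      (∀ a x i j, DifferentiableAt ℝ (fun y => A a y i j) x) →
      (∀ a x i j, |pd (fun y => A a y i j) a x| ≤ M) →
      (∀ x i j, |B x i j| ≤ M) → (∀ a x i j, A a x i j = A a x j i) →
      (∀ i, MemLp (fun x => F x i) 2 (weightedVolume δ)) →
      (∀ i, MemLp (fun x => U x i) 2 (weightedVolume δ)) →
      (∀ i, MemLp (fun x => V x i) 2 (weightedVolume δ)) →
      (∀ x i, DifferentiableAt ℝ (fun y => U y i) x) →
      (∀ᵐ x ∂weightedVolume δ, ∀ i,
        V x i + (∑ a : Fin 3, ∑ j, A a x i j * pd (fun y => U y j) a x) +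
          (∑ j, B x i j * U x j) = F x i) →
      ∑ i, ∫ x, U x i * V x i ∂weightedVolume δ ≤
        C * ((∑ i, ∫ x, U x i ^ 2 ∂weightedVolume δ) +
          ∑ i, ∫ x, F x i ^ 2 ∂weightedVolume δ) := by
  obtain ⟨K, hK0, hK⟩ := exists_abs_integral_weight_mul_div_le δ
  refine ⟨1 / 2 + 5 / 2 * (|M| * N) + 3 / 2 * K * (|M| * N), by positivity, ?_⟩
  intro A B F U V hA hAd hA' hB hsymm hF hU hV hUd heq
  let q : Fin 3 → E3 → ℝ := fun a x => ∑ i, ∑ j, A a x i j * U x i * U x j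
  let dq : E3 → ℝ := fun x => ∑ a, pd (q a) a x
  let S : E3 → ℝ := fun x => ∑ i, U x i ^ 2
  let SF : E3 → ℝ := fun x => ∑ i, F x i ^ 2
  let UV : E3 → ℝ := fun x => ∑ i, U x i * V x i
  have hqd : ∀ a, Differentiable ℝ (q a) := fun a x =>
    DifferentiableAt.fun_sum fun i _ => DifferentiableAt.fun_sum fun j _ =>
      ((hAd a x i j).mul (hUd x i)).mul (hUd x j)
  have hSi : Integrable S (weightedVolume δ) :=
    integrable_finsetSum _ fun i _ => (hU i).integrable_sq
  have hSFi : Integrable SF (weightedVolume δ) :=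
    integrable_finsetSum _ fun i _ => (hF i).integrable_sq
  have hUVi : ∀ i, Integrable (fun x => U x i * V x i) (weightedVolume δ) := fun i =>
    (hU i).integrable_mul (hV i)
  have hUVsum : Integrable UV (weightedVolume δ) := integrable_finsetSum _ fun i _ => hUVi i
  have hqb : ∀ a x, |q a x| ≤ |M| * N * S x := fun a x => abs_sum_mul_mul_le (hA a x) (U x)
  have hqi : ∀ a, Integrable (q a) (weightedVolume δ) := fun a =>
    (hSi.const_mul _).mono' (hqd a).continuous.aestronglyMeasurable
      (Filter.Eventually.of_forall (hqb a))
  have hpt : ∀ᵐ x ∂weightedVolume δ, |UV x + dq x / 2| ≤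
      (1 / 2 + 5 / 2 * (|M| * N)) * S x + 1 / 2 * SF x := by
    filter_upwards [heq] with x hx
    have hdq : dq x = (∑ a : Fin 3, ∑ i, ∑ j, pd (fun y => A a y i j) a x * U x i * U x j) +
        2 * ∑ i, U x i * ∑ a : Fin 3, ∑ j, A a x i j * pd (fun y => U y j) a x := by
      simp only [dq, q]
      rw [Finset.sum_congr rfl fun a _ =>
        pd_quadratic (A := A a) (hAd a x) (hUd x) (hsymm a x) a, Finset.sum_add_distrib,
        ← Finset.mul_sum]
      congr 2
      rw [Finset.sum_comm]
      simp only [Finset.mul_sum]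
    have hUVx : UV x = (∑ i, U x i * F x i) - (∑ i, ∑ j, B x i j * U x i * U x j) -
        ∑ i, U x i * ∑ a : Fin 3, ∑ j, A a x i j * pd (fun y => U y j) a x := by
      simp only [UV]
      rw [← Finset.sum_sub_distrib, ← Finset.sum_sub_distrib]
      refine Finset.sum_congr rfl fun i _ => ?_
      have hBU : ∑ j, B x i j * U x i * U x j = U x i * ∑ j, B x i j * U x j := by
        rw [Finset.mul_sum]
        exact Finset.sum_congr rfl fun j _ => by ring
      rw [hBU, ← hx i]
      ring
    have hUF : |∑ i, U x i * F x i| ≤ 1 / 2 * S x + 1 / 2 * SF x := by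
      simp only [S, SF]
      rw [Finset.mul_sum, Finset.mul_sum, ← Finset.sum_add_distrib]
      refine (Finset.abs_sum_le_sum_abs _ _).trans (Finset.sum_le_sum fun i _ => ?_)
      rw [abs_le]
      constructor <;> nlinarith [sq_nonneg (U x i - F x i), sq_nonneg (U x i + F x i)]
    have hBb : |∑ i, ∑ j, B x i j * U x i * U x j| ≤ |M| * N * S x :=
      abs_sum_mul_mul_le (hB x) (U x)
    have hdA : |∑ a : Fin 3, ∑ i, ∑ j, pd (fun y => A a y i j) a x * U x i * U x j| ≤
        3 * (|M| * N * S x) := by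
      refine (Finset.abs_sum_le_sum_abs _ _).trans ((Finset.sum_le_sum fun a _ =>
        abs_sum_mul_mul_le (hA' a x) (U x)).trans_eq ?_)
      simp [S]
    rw [hUVx, hdq]
    rw [abs_le] at hUF hBb hdA ⊢
    constructor <;> linarith
  have hPm : AEStronglyMeasurable (fun x => UV x + dq x / 2) (weightedVolume δ) :=
    hUVsum.1.add ((Finset.measurable_fun_sum _ fun a _ => measurable_pd (q a) a).div_const
      2).aestronglyMeasurable
  have hbi : Integrable (fun x => (1 / 2 + 5 / 2 * (|M| * N)) * S x + 1 / 2 * SF x)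
      (weightedVolume δ) := (hSi.const_mul _).add (hSFi.const_mul _)
  have hPi : Integrable (fun x => UV x + dq x / 2) (weightedVolume δ) := hbi.mono' hPm hpt
  have hdqi : Integrable dq (weightedVolume δ) :=
    ((hPi.sub hUVsum).const_mul 2).congr (Filter.Eventually.of_forall fun x => by
      simp only [Pi.sub_apply]; ring)
  have hdiv := hK q hqd (fun a => integrable_weightedVolume_iff.1 (hqi a))
    (integrable_weightedVolume_iff.1 hdqi)
  simp only [← integral_weightedVolume] at hdiv
  have hqint : ∑ a, ∫ x, |q a x| ∂weightedVolume δ ≤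
      3 * (|M| * N * ∫ x, S x ∂weightedVolume δ) := by
    refine (Finset.sum_le_sum fun a _ => integral_mono (hqi a).abs (hSi.const_mul _)
      (hqb a)).trans_eq ?_
    simp [integral_const_mul]
  have hPint : ∫ x, UV x + dq x / 2 ∂weightedVolume δ ≤
      (1 / 2 + 5 / 2 * (|M| * N)) * ∫ x, S x ∂weightedVolume δ +
        1 / 2 * ∫ x, SF x ∂weightedVolume δ := by
    rw [← integral_const_mul, ← integral_const_mul, ← integral_add (hSi.const_mul _)
      (hSFi.const_mul _)]
    exact integral_mono_ae hPi hbi (hpt.mono fun x hx => (le_abs_self _).trans hx)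
  rw [integral_add hUVsum (hdqi.div_const 2), integral_div] at hPint
  rw [← integral_finsetSum _ fun i _ => hUVi i,
    ← integral_finsetSum _ fun i _ => (hU i).integrable_sq,
    ← integral_finsetSum _ fun i _ => (hF i).integrable_sq]
  change ∫ x, UV x ∂weightedVolume δ ≤ _ * (∫ x, S x ∂weightedVolume δ +
    ∫ x, SF x ∂weightedVolume δ)
  change |∫ x, dq x ∂weightedVolume δ| ≤ _ at hdiv
  have hSF0 : 0 ≤ ∫ x, SF x ∂weightedVolume δ :=
    integral_nonneg fun x => Finset.sum_nonneg fun i _ => sq_nonneg _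
  have hKq := (neg_le_of_abs_le (hdiv.trans (mul_le_mul_of_nonneg_left hqint hK0)))
  have hextra : 0 ≤ (5 / 2 * (|M| * N) + 3 / 2 * K * (|M| * N)) * ∫ x, SF x ∂weightedVolume δ := by
    positivity
  linarith

/-- Energy estimate in `L²_δ` for linear symmetric hyperbolic
systems. If `A^a` are symmetric with `A^a`, `∂ₐA^a` and `B` bounded on
`[0,T] × ℝ³` (by `M`), `F(t,·) ∈ L²_δ` and `U ∈ C¹([0,T],L²_δ)` solves
`∂ₜU + Σₐ Aᵃ∂ₐU + BU = F`, then
`(1/2)(d/dt)‖U(t)‖²_{L²_δ} ≤ C(‖U(t)‖²_{L²_δ} + ‖F(t)‖²_{L²_δ})` with `C` depending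
only on `δ` and the `L^∞` norms of `A^a`, `∂ₐA^a` and `B`. -/
theorem linear_energy_estimate_L2 (δ : ℝ) (N : ℕ) (hN : 1 ≤ N) (M : ℝ) :
    ∃ C : ℝ, 0 < C ∧
      ∀ (T : ℝ), 0 < T →
      ∀ (A : Fin 3 → ℝ → E3 → Fin N → Fin N → ℝ)
        (B : ℝ → E3 → Fin N → Fin N → ℝ) (F U : ℝ → E3 → Fin N → ℝ),
      (∀ a, ∀ t ∈ Icc (0:ℝ) T, ∀ x i j, |A a t x i j| ≤ M) →
      (∀ a, ∀ t ∈ Icc (0:ℝ) T, ∀ (x : E3) i j,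
        DifferentiableAt ℝ (fun y => A a t y i j) x ∧
        |pd (fun y => A a t y i j) a x| ≤ M) →
      (∀ t ∈ Icc (0:ℝ) T, ∀ x i j, |B t x i j| ≤ M) →
      (∀ a, ∀ t ∈ Icc (0:ℝ) T, ∀ x i j, A a t x i j = A a t x j i) →
      (∀ t ∈ Icc (0:ℝ) T, ∀ i, MemL2w δ (fun x => F t x i)) →
      (∀ i, L2ContOn δ T (fun t x => U t x i)) →
      (∀ i, L2C1On δ T (fun t x => U t x i)) →
      (∀ t ∈ Icc (0:ℝ) T, ∀ x : E3,
        (∀ i, DifferentiableAt ℝ (fun y => U t y i) x) ∧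
        ∀ i : Fin N, ∃ dU : ℝ,
          HasDerivWithinAt (fun τ => U τ x i) dU (Icc (0:ℝ) T) t ∧
          dU + (∑ a : Fin 3, ∑ j : Fin N, A a t x i j * pd (fun y => U t y j) a x) +
            (∑ j : Fin N, B t x i j * U t x j) = F t x i) →
      ∃ D : ℝ → ℝ, ∀ t ∈ Icc (0:ℝ) T,
        HasDerivWithinAt
          (fun τ => ∑ i, (L2wNormSq δ (fun x => U τ x i)).toReal) (D t)
          (Icc (0:ℝ) T) t ∧
        (1/2) * D t ≤ C * ((∑ i, L2wNorm δ (fun x => U t x i) ^ 2) +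
          (∑ i, L2wNorm δ (fun x => F t x i) ^ 2)) := by
  obtain ⟨C, hC, hest⟩ := exists_integral_sum_mul_le δ N M
  refine ⟨C, hC, fun T hT A B F U hA hA' hB hsymm hF hU hU1 heq => ?_⟩
  choose u' hu'c hu'd using hU1
  refine ⟨fun t => ∑ i, 2 * ∫ x, U t x i * u' i t x ∂weightedVolume δ, fun t ht => ⟨?_, ?_⟩⟩
  · exact HasDerivWithinAt.fun_sum fun i _ =>
      HasL2DerivAt.hasDerivWithinAt_normSq (hU i).1 ((hu'c i).1 t ht) ht (hu'd i t ht)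
  · choose hUd v hv hveq using heq t ht
    have hae : ∀ i, u' i t =ᵐ[weightedVolume δ] fun x => v x i := fun i =>
      HasL2DerivAt.ae_eq_of_hasDerivWithinAt hT (hU i).1 ((hu'c i).1 t ht) ht (hu'd i t ht)
        fun x => hv x i
    have h := hest (fun a => A a t) (B t) (F t) (U t) (fun x i => u' i t x)
      (fun a => hA a t ht) (fun a x i j => (hA' a t ht x i j).1)
      (fun a x i j => (hA' a t ht x i j).2) (hB t ht) (fun a => hsymm a t ht)
      (fun i => (hF t ht i).memLp) (fun i => ((hU i).1 t ht).memLp)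
      (fun i => ((hu'c i).1 t ht).memLp) hUd
      (by
        filter_upwards [ae_all_iff.2 hae] with x hx i
        rw [hx i]
        exact hveq x i)
    rw [Finset.sum_congr rfl fun i _ => ((hU i).1 t ht).L2wNorm_sq_eq_integral,
      Finset.sum_congr rfl fun i _ => (hF t ht i).L2wNorm_sq_eq_integral]
    simp only [← Finset.mul_sum]
    linarith
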